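/- Let n≥1 and p>n. Then there exists a positive constant C, depending only on n and p, such that for every u ∈ C_c^∞(ℝ^n) and all x, h ∈ ℝ^n, |u(x+h) − u(x)| ≤ C ‖∇u‖_{L^p(ℝ^n)} |h|^{1 − n/p}. -/

import Mathlib

open MeasureTheory

noncomputable section

lemma morrey_scale (n : ℕ) (p : ℝ) (hp0 : 0 < p) (g : EuclideanSpace ℝ (Fin n) → ℝ)
    (hg : Continuous g) (b : EuclideanSpace ℝ (Fin n)) (s : ℝ) (hs : 0 < s) :
    eLpNorm (fun z => g (b + s • z)) (ENNReal.ofReal p) volume =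
      ENNReal.ofReal (s ^ (-((n : ℝ) / p))) * eLpNorm g (ENNReal.ofReal p) volume := by
  have h1 : eLpNorm (fun z => g (b + s • z)) (ENNReal.ofReal p) volume =
      eLpNorm (fun z => g (b + z)) (ENNReal.ofReal p)
        (Measure.map (fun z : EuclideanSpace ℝ (Fin n) => s • z) volume) := by
    rw [eLpNorm_map_measure]
    · rfl
    · exact (hg.comp (by fun_prop)).aestronglyMeasurable
    · fun_prop
  have h2 : eLpNorm (fun z => g (b + z)) (ENNReal.ofReal p) volume =
      eLpNorm g (ENNReal.ofReal p) volume :=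
    eLpNorm_comp_measurePreserving (hg.aestronglyMeasurable) (measurePreserving_add_left volume b)
  rw [h1, Measure.map_addHaar_smul _ hs.ne', eLpNorm_smul_measure_of_ne_top ENNReal.ofReal_ne_top,
    h2, smul_eq_mul]
  congr 1
  rw [one_div, ENNReal.toReal_inv, ENNReal.toReal_ofReal hp0.le, ENNReal.ofReal_rpow_of_nonneg (abs_nonneg _) (by positivity)]
  congr 1
  rw [finrank_euclideanSpace_fin, abs_of_pos (by positivity), ← Real.rpow_natCast,
    ← Real.rpow_neg hs.le, ← Real.rpow_mul hs.le]
  congr 1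
  ring

lemma morrey_holder (n : ℕ) (p : ℝ) (hp1 : 1 ≤ p) (g : EuclideanSpace ℝ (Fin n) → ℝ)
    (hg : Continuous g) (b : EuclideanSpace ℝ (Fin n)) (s : ℝ) (hs : 0 < s)
    (B : Set (EuclideanSpace ℝ (Fin n))) :
    ∫⁻ z in B, ‖g (b + s • z)‖ₑ ≤ ENNReal.ofReal (s ^ (-((n : ℝ) / p))) *
      eLpNorm g (ENNReal.ofReal p) volume * volume B ^ (1 - 1 / p) := by
  have hp0 : 0 < p := by linarith
  rw [← morrey_scale n p hp0 g hg b s hs, ← eLpNorm_one_eq_lintegral_enorm]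
  refine (eLpNorm_le_eLpNorm_mul_rpow_measure_univ (p := 1) (q := ENNReal.ofReal p)
    (by simpa using hp1) (hg.comp (by fun_prop)).aestronglyMeasurable).trans ?_
  rw [ENNReal.toReal_ofReal hp0.le]
  simp only [ENNReal.toReal_one, div_one, Measure.restrict_apply_univ]
  gcongr
  exact eLpNorm_restrict_le ..

lemma morrey_ftc (n : ℕ) (u : EuclideanSpace ℝ (Fin n) → ℝ) (hu : ContDiff ℝ (⊤ : ℕ∞) u)
    (a w : EuclideanSpace ℝ (Fin n)) :
    ‖u (a + w) - u a‖ₑ ≤ ∫⁻ t in Set.Ioc (0 : ℝ) 1, ‖‖fderiv ℝ u (a + t • w)‖‖ₑ * ‖w‖ₑ := by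
  have h1 : ContDiff ℝ 1 (fun t : ℝ => u (a + t • w)) :=
    (hu.of_le (by exact_mod_cast le_top)).comp (by fun_prop)
  have := enorm_sub_le_lintegral_deriv_of_contDiffOn_Icc (h1.contDiffOn (s := Set.Icc 0 1))
    zero_le_one
  simp only [one_smul, zero_smul, add_zero] at this
  refine this.trans ?_
  rw [← restrict_Ioc_eq_restrict_Icc]
  refine lintegral_mono fun t => ?_
  have hd : HasDerivAt (fun t : ℝ => u (a + t • w)) (fderiv ℝ u (a + t • w) w) t := by
    have hu' : HasFDerivAt u (fderiv ℝ u (a + t • w)) (a + t • w) :=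
      (hu.differentiable (by simp) _).hasFDerivAt
    have hl : HasDerivAt (fun t : ℝ => a + t • w) w t := by
      simpa using ((hasDerivAt_id t).smul_const w).const_add a
    exact hu'.comp_hasDerivAt t hl
  rw [hd.deriv, enorm_norm]
  exact ContinuousLinearMap.le_opENorm _ _

lemma morrey_avg (n : ℕ) (p : ℝ) (hp1 : 1 ≤ p)
    (u : EuclideanSpace ℝ (Fin n) → ℝ) (hu : ContDiff ℝ (⊤ : ℕ∞) u)
    (a e : EuclideanSpace ℝ (Fin n)) (he : ‖e‖ ≤ 1) (r : ℝ) (hr : 0 < r) :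
    ∫⁻ z in Metric.ball (0 : EuclideanSpace ℝ (Fin n)) 1, ‖u (a + r • (z + e)) - u a‖ₑ ≤
      ENNReal.ofReal (2 * r) * (ENNReal.ofReal (r ^ (-((n : ℝ) / p))) *
      (eLpNorm (fun y => ‖fderiv ℝ u y‖) (ENNReal.ofReal p) volume *
        volume (Metric.ball (0 : EuclideanSpace ℝ (Fin n)) 1) ^ (1 - 1 / p) *
        ∫⁻ t in Set.Ioc (0 : ℝ) 1, ENNReal.ofReal (t ^ (-((n : ℝ) / p))))) := by
  have hg : Continuous (fun y => ‖fderiv ℝ u y‖) := (hu.continuous_fderiv (by simp)).norm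
  set g := fun y => ‖fderiv ℝ u y‖ with hgdef
  set B := Metric.ball (0 : EuclideanSpace ℝ (Fin n)) 1 with hB
  calc ∫⁻ z in B, ‖u (a + r • (z + e)) - u a‖ₑ
      ≤ ∫⁻ z in B, ENNReal.ofReal (2 * r) *
          ∫⁻ t in Set.Ioc (0 : ℝ) 1, ‖g ((a + (t * r) • e) + (t * r) • z)‖ₑ := by
        refine setLIntegral_mono' Metric.isOpen_ball.measurableSet fun z hz => ?_
        refine (morrey_ftc n u hu a _).trans ?_
        rw [lintegral_mul_const' _ _ (by simp), mul_comm]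
        have hz1 : ‖z‖ < 1 := by simpa [hB] using hz
        gcongr ?_ * ?_
        · rw [← ofReal_norm, norm_smul, Real.norm_of_nonneg hr.le]
          apply ENNReal.ofReal_le_ofReal
          have := norm_add_le z e
          nlinarith
        · refine lintegral_mono fun t => le_of_eq ?_
          simp only [hgdef]
          have e1 : a + t • r • (z + e) = a + (t * r) • e + (t * r) • z := by
            rw [smul_smul, smul_add]
            abel
          rw [e1]
    _ = ENNReal.ofReal (2 * r) * ∫⁻ t in Set.Ioc (0 : ℝ) 1, ∫⁻ z in B,
          ‖g ((a + (t * r) • e) + (t * r) • z)‖ₑ := by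
        rw [lintegral_const_mul' _ _ ENNReal.ofReal_ne_top, lintegral_lintegral_swap]
        refine Continuous.aemeasurable ?_
        exact (hg.comp (by fun_prop)).enorm
    _ ≤ ENNReal.ofReal (2 * r) * ∫⁻ t in Set.Ioc (0 : ℝ) 1,
          ENNReal.ofReal (r ^ (-((n : ℝ) / p))) *
          (eLpNorm g (ENNReal.ofReal p) volume * volume B ^ (1 - 1 / p)) *
            ENNReal.ofReal (t ^ (-((n : ℝ) / p))) := by
        refine mul_le_mul_right ?_ _
        refine setLIntegral_mono' measurableSet_Ioc fun t ht => ?_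
        refine (morrey_holder n p hp1 g hg _ _ (mul_pos ht.1 hr) B).trans (le_of_eq ?_)
        rw [Real.mul_rpow ht.1.le hr.le, ENNReal.ofReal_mul (Real.rpow_nonneg ht.1.le _)]
        ring
    _ = _ := by
        rw [lintegral_const_mul]
        · ring
        · fun_prop

/-- the Morrey inequality for `u ∈ C_c^∞(ℝ^n)` with `p > n`. -/
theorem stmt7 (n : ℕ) (hn : 1 ≤ n) (p : ℝ) (hp : (n : ℝ) < p) :
    ∃ C : ℝ, 0 < C ∧ ∀ u : EuclideanSpace ℝ (Fin n) → ℝ,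
      ContDiff ℝ (⊤ : ℕ∞) u → HasCompactSupport u →
      ∀ x h : EuclideanSpace ℝ (Fin n),
        |u (x + h) - u x| ≤
          C * (eLpNorm (fun y => ‖fderiv ℝ u y‖) (ENNReal.ofReal p) volume).toReal *
            ‖h‖ ^ (1 - (n : ℝ) / p) := by
  have hn1 : (1 : ℝ) ≤ n := by exact_mod_cast hn
  have hp1 : 1 ≤ p := by linarith
  have hp0 : 0 < p := by linarith
  have hnp : (n : ℝ) / p < 1 := by rwa [div_lt_one hp0]
  set V := volume (Metric.ball (0 : EuclideanSpace ℝ (Fin n)) 1) with hV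
  set K := ∫⁻ t in Set.Ioc (0 : ℝ) 1, ENNReal.ofReal (t ^ (-((n : ℝ) / p))) with hK
  have hV0 : V ≠ 0 := (Metric.measure_ball_pos volume _ one_pos).ne'
  have hVt : V ≠ ⊤ := measure_ball_lt_top.ne
  have hKt : K ≠ ⊤ := by
    have := intervalIntegral.intervalIntegrable_rpow' (a := 0) (b := 1)
      (r := -((n : ℝ) / p)) (by linarith)
    rw [intervalIntegrable_iff_integrableOn_Ioc_of_le zero_le_one] at this
    exact this.lintegral_lt_top.ne
  have hVp : V ^ (1 - 1 / p) ≠ ⊤ := by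
    refine ENNReal.rpow_ne_top_of_nonneg ?_ hVt
    rw [sub_nonneg, div_le_one hp0]; exact hp1
  have hVr : 0 < V.toReal := ENNReal.toReal_pos hV0 hVt
  refine ⟨4 * (V ^ (1 - 1 / p)).toReal * K.toReal / V.toReal + 1, by positivity, ?_⟩
  intro u hu hcs x h
  set N := eLpNorm (fun y => ‖fderiv ℝ u y‖) (ENNReal.ofReal p) volume with hN
  have hNt : N ≠ ⊤ := by
    have hc : Continuous (fun y => ‖fderiv ℝ u y‖) := (hu.continuous_fderiv (by simp)).norm
    exact (hc.memLp_of_hasCompactSupport (hcs.fderiv (𝕜 := ℝ)).norm).2.ne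
  rcases eq_or_ne h 0 with rfl | hh
  · simp only [add_zero, sub_self, abs_zero]; positivity
  have hr : 0 < ‖h‖ := norm_pos_iff.2 hh
  set r := ‖h‖ with hrdef
  have A1 := morrey_avg n p hp1 u hu (x + h) 0 (by simp) r hr
  have A2 := morrey_avg n p hp1 u hu x (r⁻¹ • h)
    (by rw [norm_smul, norm_inv, norm_norm, inv_mul_cancel₀ hr.ne']) r hr
  rw [← hN, ← hV, ← hK] at A1 A2
  set R := ENNReal.ofReal (2 * r) * (ENNReal.ofReal (r ^ (-((n : ℝ) / p))) *
      (N * V ^ (1 - 1 / p) * K)) with hR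
  have hRt : R ≠ ⊤ := by
    rw [hR]
    finiteness
  have key : ‖u (x + h) - u x‖ₑ * V ≤ R + R := by
    refine le_trans ?_ (add_le_add A1 A2)
    rw [hV, ← setLIntegral_const, ← lintegral_add_left]
    · refine lintegral_mono fun z => ?_
      have e1 : x + h + r • (z + 0) = x + r • (z + r⁻¹ • h) := by
        rw [add_zero, smul_add, smul_smul, mul_inv_cancel₀ hr.ne', one_smul]
        abel
      simp only [e1]
      rw [← edist_eq_enorm_sub, ← edist_eq_enorm_sub, ← edist_eq_enorm_sub, edist_comm (u (x + r • _)) (u (x + h))]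
      exact edist_triangle _ _ _
    · have := hu.continuous
      exact Continuous.measurable (by fun_prop)
  have key2 := ENNReal.toReal_mono (by finiteness) key
  rw [ENNReal.toReal_mul, toReal_enorm, Real.norm_eq_abs, ENNReal.toReal_add hRt hRt, hR] at key2
  simp only [ENNReal.toReal_mul] at key2
  rw [ENNReal.toReal_ofReal (by positivity), ENNReal.toReal_ofReal (by positivity)] at key2
  have hrr : r ^ (1 - (n : ℝ) / p) = r * r ^ (-((n : ℝ) / p)) := by
    rw [sub_eq_add_neg, Real.rpow_add hr, Real.rpow_one]
  rw [hrr]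
  rw [← le_div_iff₀ hVr] at key2
  refine key2.trans ?_
  have hpos : 0 ≤ N.toReal * (r * r ^ (-((n : ℝ) / p))) := by positivity
  calc _ = 4 * (V ^ (1 - 1 / p)).toReal * K.toReal / V.toReal *
        (N.toReal * (r * r ^ (-((n : ℝ) / p)))) := by ring
    _ ≤ _ := by linarith
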